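/- Let n ≥ 2 and let m₁, …, m_n be integers with mᵢ ≥ 2 for all i. Let Γ be the group with generators γ₁, …, γ_n and defining relations γ₁^{m₁} = γ₂, γᵢ^{mᵢ} = γ_{i−1}γ_{i+1} for 2 ≤ i ≤ n−1, and γ_n^{m_n} = γ_{n−1}. Define a₁ = 1, a₂ = m₁, a_{i+1} = mᵢ·aᵢ − a_{i−1} for 2 ≤ i ≤ n. Then in Γ the image of γᵢ equals γ₁^{aᵢ} for every i, and each γᵢ is a nontrivial element of Γ. -/

import Mathlib

/-- The relators of the local fundamental group of a linear chain of `n` smooth rational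
curves with self-intersections `−m₁, …, −m_n` (the generator `i : Fin n` is the loop `γ_{i+1}`
around the `(i+1)`-st curve, and `m` is indexed starting from `1`): the relation at the `i`-th
vertex is `γᵢ^{mᵢ} = γ_{i−1}·γ_{i+1}` (with the missing neighbours omitted at the two ends). -/
def chainRelator (n : ℕ) (m : ℕ → ℤ) (i : Fin n) : FreeGroup (Fin n) :=
  FreeGroup.of i ^ (m (i.1 + 1)) *
    ((if _ : 0 < i.1 then FreeGroup.of (⟨i.1 - 1, by have := i.2; omega⟩ : Fin n) else 1) *
     (if h : i.1 + 1 < n then FreeGroup.of (⟨i.1 + 1, h⟩ : Fin n) else 1))⁻¹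

theorem chainRelator_relation (n : ℕ) (m : ℕ → ℤ) (i : Fin n) :
    PresentedGroup.of (rels := Set.range (chainRelator n m)) i ^ m (i.1 + 1) =
      (if _ : 0 < i.1 then PresentedGroup.of (rels := Set.range (chainRelator n m))
          (⟨i.1 - 1, by have := i.2; omega⟩ : Fin n) else 1) *
      (if h : i.1 + 1 < n then PresentedGroup.of (rels := Set.range (chainRelator n m))
          (⟨i.1 + 1, h⟩ : Fin n) else 1) := by
  have h : PresentedGroup.mk (Set.range (chainRelator n m)) (chainRelator n m i) = 1 :=
    PresentedGroup.one_of_mem ⟨i, rfl⟩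
  rw [chainRelator, map_mul, map_inv, mul_inv_eq_one, map_zpow, map_mul] at h
  refine h.trans ?_
  split_ifs <;> simp [PresentedGroup.of]

/-- The sequence attached to a chain is positive and strictly increasing. -/
theorem chain_sequence_pos_lt (n : ℕ) (m a : ℕ → ℤ)
    (hm : ∀ i, 1 ≤ i → i ≤ n → 2 ≤ m i)
    (ha1 : a 1 = 1) (ha2 : a 2 = m 1)
    (harec : ∀ i, 2 ≤ i → i ≤ n → a (i + 1) = m i * a i - a (i - 1))
    (k : ℕ) (hk : k < n) : 0 < a (k + 1) ∧ a (k + 1) < a (k + 2) := by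
  induction k with
  | zero =>
    have := hm 1 le_rfl hk
    simp only [zero_add, ha1, ha2]
    omega
  | succ k ih =>
    obtain ⟨h0, h1⟩ := ih (by omega)
    have h2 := harec (k + 2) (by omega) (by omega)
    have h3 := hm (k + 2) (by omega) (by omega)
    simp only [show k + 2 - 1 = k + 1 by omega] at h2
    refine ⟨h0.trans h1, ?_⟩
    change a (k + 2) < a (k + 2 + 1)
    nlinarith

theorem chain_sequence_lt_last (n : ℕ) (m a : ℕ → ℤ)
    (hm : ∀ i, 1 ≤ i → i ≤ n → 2 ≤ m i)
    (ha1 : a 1 = 1) (ha2 : a 2 = m 1)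
    (harec : ∀ i, 2 ≤ i → i ≤ n → a (i + 1) = m i * a i - a (i - 1))
    (k : ℕ) (hk : k < n) : a (k + 1) < a (n + 1) := by
  obtain ⟨d, rfl⟩ := Nat.exists_eq_add_of_lt hk
  have key : ∀ e ≤ d, a (k + 1) < a (k + e + 2) := by
    intro e he
    induction e with
    | zero => exact (chain_sequence_pos_lt _ m a hm ha1 ha2 harec k (by omega)).2
    | succ e ih =>
      exact (ih (by omega)).trans
        (chain_sequence_pos_lt _ m a hm ha1 ha2 harec (k + e + 1) (by omega)).2
  exact key d le_rfl

/-- Sending the `i`-th loop to `aᵢ` kills the chain relators modulo `a_{n+1}`. -/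
theorem lift_chainRelator_eq_one (n : ℕ) (hn : 2 ≤ n) (m a : ℕ → ℤ)
    (ha1 : a 1 = 1) (ha2 : a 2 = m 1)
    (harec : ∀ i, 2 ≤ i → i ≤ n → a (i + 1) = m i * a i - a (i - 1))
    (N : ℕ) (hN : (N : ℤ) = a (n + 1)) (i : Fin n) :
    FreeGroup.lift (fun j : Fin n => Multiplicative.ofAdd ((a (j.1 + 1) : ℤ) : ZMod N))
      (chainRelator n m i) = 1 := by
  have hz : ((a (n + 1) : ℤ) : ZMod N) = 0 := by rw [← hN]; simp
  obtain ⟨i, hi⟩ := i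
  rw [chainRelator, map_mul, map_inv, mul_inv_eq_one, map_zpow, map_mul]
  rcases Nat.eq_zero_or_pos i with rfl | hpos
  · have h1 : 0 + 1 < n := by omega
    simp [h1, ha1, ha2, ← ofAdd_zsmul]
  · obtain ⟨i, rfl⟩ := Nat.exists_eq_add_of_lt hpos
    have hr := harec (0 + i + 1 + 1) (by omega) (by omega)
    have hr' : m (0 + i + 1 + 1) * a (0 + i + 1 + 1) =
        a (0 + i + 1) + a (0 + i + 1 + 1 + 1) := by
      simp only [Nat.add_sub_cancel] at hr
      linarith
    have hc := congrArg (Int.cast : ℤ → ZMod N) hr'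
    push_cast at hc
    by_cases h1 : 0 + i + 1 + 1 < n
    · simp only [hpos, h1, dite_true, FreeGroup.lift_apply_of, Nat.add_sub_cancel,
        ← ofAdd_zsmul, ← ofAdd_add, zsmul_eq_mul, hc]
    · obtain rfl : n = 0 + i + 1 + 1 := by omega
      rw [hz, add_zero] at hc
      simp only [hpos, h1, dite_true, dite_false, map_one, mul_one, FreeGroup.lift_apply_of,
        Nat.add_sub_cancel, ← ofAdd_zsmul, zsmul_eq_mul, hc]

theorem chain_generator_eq_zpow (n : ℕ) (hn : 2 ≤ n) (m a : ℕ → ℤ)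
    (ha1 : a 1 = 1) (ha2 : a 2 = m 1)
    (harec : ∀ i, 2 ≤ i → i ≤ n → a (i + 1) = m i * a i - a (i - 1)) (k : ℕ) (hk : k < n) :
    PresentedGroup.of (rels := Set.range (chainRelator n m)) (⟨k, hk⟩ : Fin n)
      = PresentedGroup.of (rels := Set.range (chainRelator n m)) (⟨0, by omega⟩ : Fin n)
          ^ (a (k + 1)) := by
  induction k using Nat.strong_induction_on with
  | _ k ih =>
    match k with
    | 0 => simp [ha1]
    | 1 =>
      have h := chainRelator_relation n m ⟨0, by omega⟩
      simp only [lt_irrefl, dite_false, one_mul, zero_add, hk, dite_true] at h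
      simpa only [ha2, Nat.reduceAdd] using h.symm
    | k + 2 =>
      have h := chainRelator_relation n m ⟨k + 1, by omega⟩
      simp only [Nat.succ_pos, dite_true, show k + 1 + 1 < n from hk, Nat.add_sub_cancel] at h
      rw [ih (k + 1) (by omega) (by omega), ih k (by omega) (by omega)] at h
      have hr := harec (k + 2) (by omega) (by omega)
      change a (k + 2 + 1) = m (k + 2) * a (k + 2) - a (k + 1) at hr
      rw [hr, mul_comm, sub_eq_neg_add, zpow_add, zpow_neg, zpow_mul]
      exact eq_inv_mul_of_mul_eq h.symm

/-- Let `n ≥ 2` and `mᵢ ≥ 2` for `1 ≤ i ≤ n`. Let `Γ = ⟨γ₁,…,γₙ | γ₁^{m₁} = γ₂,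
γᵢ^{mᵢ} = γ_{i−1}γ_{i+1} (2 ≤ i ≤ n−1), γₙ^{mₙ} = γ_{n−1}⟩`, and define `a₁ = 1`, `a₂ = m₁`,
`a_{i+1} = mᵢaᵢ − a_{i−1}`. Then in `Γ` the image of `γᵢ` equals `γ₁^{aᵢ}` for every `i`,
and each `γᵢ` is a nontrivial element of `Γ`. -/
theorem chain_group_generators_nontrivial (n : ℕ) (hn : 2 ≤ n) (m a : ℕ → ℤ)
    (hm : ∀ i, 1 ≤ i → i ≤ n → 2 ≤ m i)
    (ha1 : a 1 = 1) (ha2 : a 2 = m 1)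
    (harec : ∀ i, 2 ≤ i → i ≤ n → a (i + 1) = m i * a i - a (i - 1)) :
    ∀ i : Fin n,
      (PresentedGroup.of (rels := Set.range (chainRelator n m)) i
          = PresentedGroup.of (rels := Set.range (chainRelator n m)) (⟨0, by omega⟩ : Fin n)
              ^ (a (i.1 + 1))) ∧
      PresentedGroup.of (rels := Set.range (chainRelator n m)) i ≠ 1 := by
  rintro ⟨i, hi⟩
  refine ⟨chain_generator_eq_zpow n hn m a ha1 ha2 harec i hi, fun h => ?_⟩
  have hpos := (chain_sequence_pos_lt n m a hm ha1 ha2 harec i hi).1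
  have hlt := chain_sequence_lt_last n m a hm ha1 ha2 harec i hi
  obtain ⟨N, hN⟩ := Int.eq_ofNat_of_zero_le (hpos.trans hlt).le
  have hrel : ∀ r ∈ Set.range (chainRelator n m),
      FreeGroup.lift (fun j : Fin n => Multiplicative.ofAdd ((a (j.1 + 1) : ℤ) : ZMod N)) r = 1 := by
    rintro _ ⟨j, rfl⟩
    exact lift_chainRelator_eq_one n hn m a ha1 ha2 harec N hN.symm j
  have h0 := congrArg (PresentedGroup.toGroup hrel) h
  rw [PresentedGroup.toGroup.of, map_one, ofAdd_eq_one, ZMod.intCast_zmod_eq_zero_iff_dvd,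
    ← hN] at h0
  exact absurd (Int.le_of_dvd hpos h0) (not_le.mpr hlt)
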